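/- Let μ = e^{−Φ} L^{2N} × H^N⌞E with Φ satisfying both the sub-Gaussian transversality condition (β₀‖y − z‖² + Φ(y) ≥ c(‖y‖² + ‖z‖²) − b for all y ∈ Z, z ∈ E) and the regularity/growth condition of the strong transversality result (Ψ(ξ,η) := Φ(ξ+η) continuously differentiable in η with ‖D₂Ψ(ξ,η)‖ ≤ C(1 + u(ξ) + ‖η‖^γ), ∫_E u e^{−c‖ξ‖²/4} dH^N < ∞). Let μ_h := (Σ_{p∈P_h} μ_D(A_p) δ_p) × H^N⌞E be discrete approximations built from partitions {A_p : p ∈ P_h} satisfying p ∈ A_p, μ_D(A_p) < ∞, ‖p − z‖² ≤ c_*²(ε_h² + ‖y − z‖²) for z ∈ E and y ∈ A_p, and ∫_{A_p} ‖y − p‖² dμ_D ≤ ε_h² μ_D(A_p), where μ_D := e^{−Φ} L^{2N}, ε_h → 0, β_h → ∞ and (β_h ε_h²) is bounded. Then there exist constants C₁, C₂ > 0 such that for all sufficiently large h, ‖(μ_h)_{β_h} − μ_∞‖_FN ≤ C₁ β_h^{−1/2} + C₂ β_h^{1/2} ε_h, where μ_∞ is defined by ∫ f dμ_∞ = ∫_E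 f(ξ,ξ) e^{−Φ(ξ)} dH^N(ξ). -/

import Mathlib

open MeasureTheory Real Filter Topology

noncomputable section

/-- Phase space `Z`, identified with `ℝ^{2N}` (with Lebesgue measure `volume`). -/
abbrev ZZ (N : ℕ) := EuclideanSpace ℝ (Fin (2 * N))

/-- The normalization constant `B_β = ∫_Z exp(−β‖ξ‖²) dL^{2N}(ξ)`. -/
def Bconst (N : ℕ) (β : ℝ) : ℝ := ∫ ξ : ZZ N, Real.exp (-β * ‖ξ‖ ^ 2)

/-- The thermalization `μ_β := w_β · μ` with `w_β(y,z) = B_β⁻¹ exp(−β‖y−z‖²)`. -/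
def therm {N : ℕ} (μ : Measure (ZZ N × ZZ N)) (β : ℝ) : Measure (ZZ N × ZZ N) :=
  μ.withDensity fun q => ENNReal.ofReal ((Bconst N β)⁻¹ * Real.exp (-β * ‖q.1 - q.2‖ ^ 2))

/-- The deterministic physical likelihood `μ_E = H^N ⌞ E`. -/
def muE (N : ℕ) (E : AffineSubspace ℝ (ZZ N)) : Measure (ZZ N) :=
  (μH[(N : ℝ)]).restrict (E : Set (ZZ N))

/-- The sub-Gaussian material likelihood `μ_D = e^{−Φ} L^{2N}`. -/
def muD (N : ℕ) (Φ : ZZ N → ℝ) : Measure (ZZ N) :=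
  volume.withDensity fun y => ENNReal.ofReal (Real.exp (-Φ y))

/-!
STATEMENT 15: total error estimate for sub-Gaussian material likelihoods approximated
by discrete measures with exact weights `m_p = μ_D(A_p)`. There exist `C₁, C₂ > 0`
such that for all sufficiently large `h`,
`‖(μ_h)_{β_h} − μ_∞‖_FN ≤ C₁ β_h^{−1/2} + C₂ β_h^{1/2} ε_h`, where
`∫ f dμ_∞ = ∫_E f(ξ,ξ) e^{−Φ(ξ)} dH^N(ξ)`. The flat norm is expressed via its
defining supremum over `f` with `‖f‖_∞ ≤ 1` and `ℓ·Lip(f) ≤ 1`.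
-/

/-! ### Scalar inequalities -/

theorem mul_exp_neg_sq_div_two_le_one (x : ℝ) : x * exp (-(x ^ 2 / 2)) ≤ 1 := by
  have h : x ≤ exp (x ^ 2 / 2) := by
    nlinarith [add_one_le_exp (x ^ 2 / 2), sq_nonneg (x - 1)]
  calc x * exp (-(x ^ 2 / 2)) ≤ exp (x ^ 2 / 2) * exp (-(x ^ 2 / 2)) := by gcongr
    _ = 1 := by rw [← exp_add]; simp

theorem mul_exp_neg_sq_div_four_le {β R : ℝ} (hβ : 0 < β) :
    R * exp (-(β * R ^ 2 / 4)) ≤ 1 / √β := by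
  have h : √β * R ≤ exp (β * R ^ 2 / 4) := by
    have h2 : (√β * R) ^ 2 = β * R ^ 2 := by rw [mul_pow, sq_sqrt hβ.le]
    nlinarith [add_one_le_exp (β * R ^ 2 / 4), sq_nonneg (√β * R / 2 - 1)]
  have hs : 0 < √β := sqrt_pos.2 hβ
  rw [le_div_iff₀ hs]
  calc R * exp (-(β * R ^ 2 / 4)) * √β = √β * R * exp (-(β * R ^ 2 / 4)) := by ring
    _ ≤ exp (β * R ^ 2 / 4) * exp (-(β * R ^ 2 / 4)) := by gcongr
    _ = 1 := by rw [← exp_add]; simp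

/-- Powers are dominated by Gaussians. -/
theorem exists_rpow_mul_exp_neg_sq_le (γ : ℝ) (hγ : 0 ≤ γ) :
    ∃ K : ℝ, 0 < K ∧ ∀ β R : ℝ, 1 ≤ β → 0 ≤ R → R ^ γ * exp (-(β * R ^ 2 / 4)) ≤ K := by
  obtain ⟨n, hn⟩ := exists_nat_ge γ
  refine ⟨1 + n.factorial * exp 1, by positivity, fun β R hβ hR => ?_⟩
  have hmono : exp (-(β * R ^ 2 / 4)) ≤ exp (-(R ^ 2 / 4)) :=
    exp_le_exp.2 (by nlinarith [sq_nonneg R])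
  have h1 : R ^ γ ≤ 1 + R ^ n := by
    rcases le_total R 1 with h | h
    · have := rpow_le_one hR h hγ
      have : 0 ≤ R ^ n := by positivity
      linarith
    · have := rpow_le_rpow_of_exponent_le h hn
      rw [rpow_natCast] at this
      linarith
  have h2 : R ^ n ≤ n.factorial * exp R := by
    have := pow_div_factorial_le_exp (x := R) hR n
    rwa [div_le_iff₀ (by positivity), mul_comm] at this
  have h3 : exp R * exp (-(R ^ 2 / 4)) ≤ exp 1 := by
    rw [← exp_add]; exact exp_le_exp.2 (by nlinarith [sq_nonneg (R / 2 - 1)])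
  have h4 : exp (-(R ^ 2 / 4)) ≤ 1 := exp_le_one_iff.2 (by nlinarith [sq_nonneg R])
  have h0 := exp_pos (-(R ^ 2 / 4))
  calc R ^ γ * exp (-(β * R ^ 2 / 4)) ≤ (1 + n.factorial * exp R) * exp (-(R ^ 2 / 4)) := by
        gcongr; linarith
    _ = exp (-(R ^ 2 / 4)) + n.factorial * (exp R * exp (-(R ^ 2 / 4))) := by ring
    _ ≤ 1 + n.factorial * exp 1 := by gcongr

theorem exp_neg_mul_sq_sub_le_of_le {β r s : ℝ} (hβ : 0 < β) (hr : 0 ≤ r) (hrs : r ≤ s) :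
    |exp (-β * s ^ 2) - exp (-β * r ^ 2)| ≤ 2 * √β * exp (-(β * r ^ 2 / 2)) * |s - r| := by
  have key := (convex_Icc r s).norm_image_sub_le_of_norm_deriv_le
    (f := fun t : ℝ => exp (-β * t ^ 2)) (C := 2 * √β * exp (-(β * r ^ 2 / 2)))
    (x := r) (y := s) (fun t _ => by fun_prop) ?_ ⟨le_rfl, hrs⟩ ⟨hrs, le_rfl⟩
  · simpa only [norm_eq_abs] using key
  · intro t ht
    have ht0 : 0 ≤ t := hr.trans ht.1
    have hd : HasDerivAt (fun t : ℝ => exp (-β * t ^ 2)) (exp (-β * t ^ 2) * (-β * (2 * t))) t := by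
      have := ((hasDerivAt_pow 2 t).const_mul (-β)).exp
      simpa using this
    rw [hd.deriv, norm_mul, norm_eq_abs, abs_exp, norm_eq_abs, abs_mul, abs_neg,
      abs_of_pos hβ, abs_of_nonneg (by positivity : 0 ≤ 2 * t)]
    have h1 := mul_exp_neg_sq_div_two_le_one (√β * t)
    have hsq : (√β * t) ^ 2 = β * t ^ 2 := by rw [mul_pow, sq_sqrt hβ.le]
    rw [hsq] at h1
    have h2 : exp (-(β * t ^ 2 / 2)) ≤ exp (-(β * r ^ 2 / 2)) := by
      apply exp_le_exp.2
      have : r ^ 2 ≤ t ^ 2 := by gcongr; exact ht.1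
      nlinarith
    have h3 : exp (-β * t ^ 2) = exp (-(β * t ^ 2 / 2)) * exp (-(β * t ^ 2 / 2)) := by
      rw [← exp_add]; congr 1; ring
    have hb : β = √β * √β := (mul_self_sqrt hβ.le).symm
    calc exp (-β * t ^ 2) * (β * (2 * t))
        = exp (-(β * t ^ 2 / 2)) * exp (-(β * t ^ 2 / 2)) * (√β * √β * (2 * t)) := by
          rw [h3, ← hb]
      _ = 2 * √β * (√β * t * exp (-(β * t ^ 2 / 2))) * exp (-(β * t ^ 2 / 2)) := by ring
      _ ≤ 2 * √β * 1 * exp (-(β * r ^ 2 / 2)) := by gcongr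
      _ = _ := by ring

/-- A Lipschitz estimate for Gaussians, with both endpoints dominated by `M`. -/
theorem abs_exp_neg_mul_sq_sub_le {β r s M : ℝ} (hβ : 0 < β) (hr : 0 ≤ r) (hs : 0 ≤ s)
    (hrM : exp (-(β * r ^ 2 / 2)) ≤ M) (hsM : exp (-(β * s ^ 2 / 2)) ≤ M) :
    |exp (-β * r ^ 2) - exp (-β * s ^ 2)| ≤ 2 * √β * M * |r - s| := by
  rcases le_total r s with h | h
  · rw [abs_sub_comm, abs_sub_comm r s]
    exact (exp_neg_mul_sq_sub_le_of_le hβ hr h).trans (by gcongr)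
  · exact (exp_neg_mul_sq_sub_le_of_le hβ hs h).trans (by gcongr)

/-! ### Gaussian integrals -/

theorem integrable_exp_neg_mul_sq_norm {V : Type*} [NormedAddCommGroup V] [InnerProductSpace ℝ V]
    [FiniteDimensional ℝ V] [MeasurableSpace V] [BorelSpace V] (μ : Measure V)
    [μ.IsAddHaarMeasure] {s : ℝ} (hs : 0 < s) :
    Integrable (fun a : V => exp (-s * ‖a‖ ^ 2)) μ := by
  have h := (GaussianFourier.integrable_cexp_neg_mul_sq_norm_add (V := V) (b := (s : ℂ))
    (by simpa using hs) 0 0).norm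
  have h' : Integrable (fun a : V => exp (-s * ‖a‖ ^ 2)) := by
    refine h.congr (ae_of_all _ fun a => ?_)
    simp [Complex.norm_exp, ← Complex.ofReal_pow]
  rw [Measure.isAddLeftInvariant_eq_smul μ volume]
  exact h'.smul_measure_nnreal

theorem Bconst_eq {N : ℕ} {β : ℝ} (hβ : 0 < β) : Bconst N β = (π / β) ^ N := by
  rw [Bconst, GaussianFourier.integral_rexp_neg_mul_sq_norm hβ]
  simp

theorem Bconst_pos {N : ℕ} {β : ℝ} (hβ : 0 < β) : 0 < Bconst N β := by
  rw [Bconst_eq hβ]; positivity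

theorem Bconst_mul_left {N : ℕ} {κ β : ℝ} (hκ : 0 < κ) (hβ : 0 < β) :
    Bconst N (κ * β) = (κ⁻¹) ^ N * Bconst N β := by
  rw [Bconst_eq hβ, Bconst_eq (mul_pos hκ hβ), ← mul_pow]
  congr 1
  field_simp

theorem lintegral_exp_neg_mul_sq_norm_eq_Bconst {N : ℕ} {β : ℝ} (hβ : 0 < β) :
    ∫⁻ ξ : ZZ N, ENNReal.ofReal (exp (-β * ‖ξ‖ ^ 2)) = ENNReal.ofReal (Bconst N β) := by
  rw [Bconst, ofReal_integral_eq_lintegral_ofReal (integrable_exp_neg_mul_sq_norm volume hβ)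
    (ae_of_all _ fun _ => (exp_pos _).le)]

/-! ### Orthogonal coordinates around the affine subspace -/

/-- The coordinates `(a, b, a') ↦ (x₀ + a + b, x₀ + a')` on `Z × E`. -/
def orthoCoord {N : ℕ} (E : AffineSubspace ℝ (ZZ N)) (x₀ : ZZ N)
    (t : (E.direction × E.directionᗮ) × E.direction) : ZZ N × ZZ N :=
  (x₀ + (t.1.1 : ZZ N) + (t.1.2 : ZZ N), x₀ + (t.2 : ZZ N))

/-- The squared distance between the two components of `orthoCoord E x₀ t`. -/
def gapSq {N : ℕ} {E : AffineSubspace ℝ (ZZ N)}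
    (t : (E.direction × E.directionᗮ) × E.direction) : ℝ :=
  ‖t.1.2‖ ^ 2 + ‖t.1.1 - t.2‖ ^ 2

theorem norm_sq_add_orthogonal {N : ℕ} (K : Submodule ℝ (ZZ N)) (a : K) (b : Kᗮ) :
    ‖(a : ZZ N) + b‖ ^ 2 = ‖b‖ ^ 2 + ‖a‖ ^ 2 := by
  have h : inner ℝ (a : ZZ N) b = 0 := b.2 a a.2
  rw [norm_add_sq_real, h]
  simp only [Submodule.coe_norm]
  ring

theorem norm_sq_orthoCoord_sub {N : ℕ} (E : AffineSubspace ℝ (ZZ N)) (x₀ : ZZ N)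
    (t : (E.direction × E.directionᗮ) × E.direction) :
    ‖(orthoCoord E x₀ t).1 - (orthoCoord E x₀ t).2‖ ^ 2 = gapSq t := by
  have h : (orthoCoord E x₀ t).1 - (orthoCoord E x₀ t).2
      = ((t.1.1 - t.2 : E.direction) : ZZ N) + t.1.2 := by
    simp only [orthoCoord, Submodule.coe_sub]
    abel
  rw [h, norm_sq_add_orthogonal]
  rfl

theorem measurable_orthoCoord {N : ℕ} (E : AffineSubspace ℝ (ZZ N)) (x₀ : ZZ N) :
    Measurable (orthoCoord E x₀) := by
  unfold orthoCoord; fun_prop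

theorem measurable_gapSq {N : ℕ} {E : AffineSubspace ℝ (ZZ N)} :
    Measurable (gapSq (E := E)) := by
  unfold gapSq; fun_prop

theorem add_mem_of_mem_direction {N : ℕ} {E : AffineSubspace ℝ (ZZ N)} {x₀ : ZZ N}
    (hx₀ : x₀ ∈ E) (a : E.direction) : x₀ + (a : ZZ N) ∈ E := by
  have := AffineSubspace.vadd_mem_of_mem_direction a.2 hx₀
  rwa [vadd_eq_add, add_comm] at this

theorem isometry_add_direction {N : ℕ} (E : AffineSubspace ℝ (ZZ N)) (x₀ : ZZ N) :
    Isometry (fun a : E.direction => x₀ + (a : ZZ N)) :=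
  Isometry.of_dist_eq fun a b => by simp [Subtype.dist_eq]

theorem measurableEmbedding_add_direction {N : ℕ} (E : AffineSubspace ℝ (ZZ N)) (x₀ : ZZ N) :
    MeasurableEmbedding (fun a : E.direction => x₀ + (a : ZZ N)) :=
  (isometry_add_direction E x₀).isClosedEmbedding.measurableEmbedding

theorem muE_eq_map {N : ℕ} (E : AffineSubspace ℝ (ZZ N)) {x₀ : ZZ N} (hx₀ : x₀ ∈ E) :
    muE N E = (μH[(N : ℝ)] : Measure E.direction).map (fun a : E.direction => x₀ + (a : ZZ N)) := by
  rw [(isometry_add_direction E x₀).map_hausdorffMeasure (Or.inl (by positivity)), muE]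
  congr 1
  ext y
  simp only [Set.mem_range, SetLike.mem_coe]
  constructor
  · intro hy
    exact ⟨⟨y - x₀, AffineSubspace.vsub_mem_direction hy hx₀⟩, by simp⟩
  · rintro ⟨a, rfl⟩
    exact add_mem_of_mem_direction hx₀ a

theorem isAddHaarMeasure_hausdorffMeasure_direction {N : ℕ} (E : AffineSubspace ℝ (ZZ N))
    (hdim : Module.finrank ℝ E.direction = N) :
    (μH[(N : ℝ)] : Measure E.direction).IsAddHaarMeasure := by
  have h := isAddHaarMeasure_hausdorffMeasure (E := E.direction)
  rwa [hdim] at h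

/-- Any Haar measure on a subspace is complemented by a measure on its orthogonal complement
so that the product is Lebesgue measure. -/
theorem exists_measurePreserving_add_orthogonal {N : ℕ} (K : Submodule ℝ (ZZ N))
    (lam : Measure K) [lam.IsAddHaarMeasure] (x₀ : ZZ N) :
    ∃ τ : Measure Kᗮ, SFinite τ ∧
      MeasurePreserving (fun t : K × Kᗮ => x₀ + (t.1 : ZZ N) + (t.2 : ZZ N))
        (lam.prod τ) volume := by
  let e : (K × Kᗮ) ≃L[ℝ] ZZ N :=
    (Submodule.prodEquivOfIsCompl K Kᗮ K.isCompl_orthogonal).toContinuousLinearEquiv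
  let ν : Measure Kᗮ := Measure.addHaar
  have : ((lam.prod ν).map e).IsAddHaarMeasure := e.isAddHaarMeasure_map _
  let k := Measure.addHaarScalarFactor (volume : Measure (ZZ N)) ((lam.prod ν).map e)
  have hk : (volume : Measure (ZZ N)) = k • (lam.prod ν).map e :=
    Measure.isAddLeftInvariant_eq_smul _ _
  have he : MeasurePreserving e (lam.prod (k • ν)) volume := by
    refine ⟨e.continuous.measurable, ?_⟩
    rw [Measure.prod_smul_right, Measure.map_smul, ← hk]
  refine ⟨k • ν, inferInstance, ?_⟩
  convert (measurePreserving_add_left volume x₀).comp he using 1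
  ext1 t
  simp [e, add_assoc]

theorem lintegral_gaussian_mul_eq_Bconst {N : ℕ} {K : Submodule ℝ (ZZ N)} {x₀ : ZZ N}
    {lam : Measure K} [SFinite lam] {τ : Measure Kᗮ} [SFinite τ]
    (hT : MeasurePreserving (fun t : K × Kᗮ => x₀ + (t.1 : ZZ N) + (t.2 : ZZ N))
      (lam.prod τ) volume) {s : ℝ} (hs : 0 < s) :
    (∫⁻ b, ENNReal.ofReal (exp (-s * ‖b‖ ^ 2)) ∂τ) *
      (∫⁻ a, ENNReal.ofReal (exp (-s * ‖a‖ ^ 2)) ∂lam) = ENNReal.ofReal (Bconst N s) := by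
  rw [← lintegral_exp_neg_mul_sq_norm_eq_Bconst hs,
    ← lintegral_sub_right_eq_self (μ := (volume : Measure (ZZ N))) _ x₀,
    ← hT.lintegral_comp (by fun_prop), mul_comm, ← lintegral_prod_mul (by fun_prop) (by fun_prop)]
  refine lintegral_congr fun t => ?_
  rw [← ENNReal.ofReal_mul (exp_pos _).le, ← exp_add, add_assoc, add_sub_cancel_left,
    norm_sq_add_orthogonal]
  congr 2
  ring

theorem integral_gaussian_mul_eq_Bconst {N : ℕ} {K : Submodule ℝ (ZZ N)} {x₀ : ZZ N}
    {lam : Measure K} [SFinite lam] {τ : Measure Kᗮ} [SFinite τ]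
    (hT : MeasurePreserving (fun t : K × Kᗮ => x₀ + (t.1 : ZZ N) + (t.2 : ZZ N))
      (lam.prod τ) volume) (s : ℝ) :
    (∫ b, exp (-s * ‖b‖ ^ 2) ∂τ) * (∫ a, exp (-s * ‖a‖ ^ 2) ∂lam) = Bconst N s := by
  rw [Bconst, ← integral_sub_right_eq_self (μ := (volume : Measure (ZZ N))) _ x₀,
    ← hT.map_eq, integral_map hT.aemeasurable (by fun_prop), mul_comm, ← integral_prod_mul]
  refine integral_congr_ae (ae_of_all _ fun t => ?_)
  simp only
  rw [← exp_add, add_assoc, add_sub_cancel_left, norm_sq_add_orthogonal]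
  congr 1
  ring

/-- Tonelli estimate against a Gaussian in the gap; the tangential majorant `X` need not be
measurable. -/
theorem lintegral_le_mul_Bconst {N : ℕ} {E : AffineSubspace ℝ (ZZ N)} {x₀ : ZZ N}
    {lam : Measure E.direction} [lam.IsAddHaarMeasure] {τ : Measure E.directionᗮ} [SFinite τ]
    (hT : MeasurePreserving
      (fun t : E.direction × E.directionᗮ => x₀ + (t.1 : ZZ N) + (t.2 : ZZ N))
      (lam.prod τ) volume) {s : ℝ} (hs : 0 < s)
    (g : (E.direction × E.directionᗮ) × E.direction → ENNReal) (hg : Measurable g)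
    (X : E.direction → ENNReal)
    (hgX : ∀ t, g t ≤ X t.1.1 * ENNReal.ofReal (exp (-s * gapSq t))) :
    ∫⁻ t, g t ∂((lam.prod τ).prod lam) ≤ (∫⁻ a, X a ∂lam) * ENNReal.ofReal (Bconst N s) := by
  have hinner : ∀ a : E.direction,
      ∫⁻ b, ∫⁻ a', g ((a, b), a') ∂lam ∂τ ≤ X a * ENNReal.ofReal (Bconst N s) := by
    intro a
    have hB := lintegral_gaussian_mul_eq_Bconst hT hs
    calc ∫⁻ b, ∫⁻ a', g ((a, b), a') ∂lam ∂τ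
        ≤ ∫⁻ b, ∫⁻ a', X a * (ENNReal.ofReal (exp (-s * ‖b‖ ^ 2)) *
            ENNReal.ofReal (exp (-s * ‖a - a'‖ ^ 2))) ∂lam ∂τ := by
          refine lintegral_mono fun b => lintegral_mono fun a' => (hgX _).trans (le_of_eq ?_)
          rw [← ENNReal.ofReal_mul (exp_pos _).le, ← exp_add, gapSq]
          congr 3
          ring
      _ = X a * ENNReal.ofReal (Bconst N s) := by
          have h1 : ∀ b : E.directionᗮ, ∫⁻ a', X a * (ENNReal.ofReal (exp (-s * ‖b‖ ^ 2)) *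
            ENNReal.ofReal (exp (-s * ‖a - a'‖ ^ 2))) ∂lam = X a *
              (ENNReal.ofReal (exp (-s * ‖b‖ ^ 2)) *
                ∫⁻ a', ENNReal.ofReal (exp (-s * ‖a'‖ ^ 2)) ∂lam) := by
            intro b
            rw [lintegral_const_mul _ (by fun_prop), lintegral_const_mul _ (by fun_prop)]
            congr 2
            exact lintegral_sub_left_eq_self
              (fun a' => ENNReal.ofReal (exp (-s * ‖a'‖ ^ 2))) a
          simp_rw [h1]
          rw [lintegral_const_mul _ (by fun_prop), lintegral_mul_const _ (by fun_prop), hB]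
  rw [lintegral_prod _ hg.aemeasurable, lintegral_prod _ hg.lintegral_prod_right'.aemeasurable,
    ← lintegral_mul_const' _ _ ENNReal.ofReal_ne_top]
  exact lintegral_mono hinner

theorem integrable_mul_exp_gapSq {N : ℕ} {E : AffineSubspace ℝ (ZZ N)} {x₀ : ZZ N}
    {lam : Measure E.direction} [lam.IsAddHaarMeasure] {τ : Measure E.directionᗮ} [SFinite τ]
    (hT : MeasurePreserving
      (fun t : E.direction × E.directionᗮ => x₀ + (t.1 : ZZ N) + (t.2 : ZZ N))
      (lam.prod τ) volume) {s : ℝ} (hs : 0 < s)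
    {F : E.direction → ℝ} (hFm : Measurable F) (hF : Integrable F lam) :
    Integrable (fun t : (E.direction × E.directionᗮ) × E.direction =>
      F t.1.1 * exp (-s * gapSq t)) ((lam.prod τ).prod lam) := by
  have hm := measurable_gapSq (E := E)
  refine ⟨by fun_prop, ?_⟩
  refine (lintegral_le_mul_Bconst hT hs _ (by fun_prop) (fun a => ‖F a‖ₑ) fun t => ?_).trans_lt
    (ENNReal.mul_lt_top hF.2 ENNReal.ofReal_lt_top)
  rw [enorm_mul, enorm_of_nonneg (exp_pos _).le]

theorem integral_mul_exp_gapSq {N : ℕ} {E : AffineSubspace ℝ (ZZ N)} {x₀ : ZZ N}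
    {lam : Measure E.direction} [lam.IsAddHaarMeasure] {τ : Measure E.directionᗮ} [SFinite τ]
    (hT : MeasurePreserving
      (fun t : E.direction × E.directionᗮ => x₀ + (t.1 : ZZ N) + (t.2 : ZZ N))
      (lam.prod τ) volume) {s : ℝ} (hs : 0 < s)
    {F : E.direction → ℝ} (hFm : Measurable F) (hF : Integrable F lam) :
    ∫ t : (E.direction × E.directionᗮ) × E.direction,
      F t.1.1 * exp (-s * gapSq t) ∂((lam.prod τ).prod lam) = (∫ a, F a ∂lam) * Bconst N s := by
  rw [integral_prod _ (integrable_mul_exp_gapSq hT hs hFm hF)]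
  have h1 : ∀ x : E.direction × E.directionᗮ, ∫ a', F x.1 * exp (-s * gapSq (x, a')) ∂lam
      = F x.1 * exp (-s * ‖x.2‖ ^ 2) * ∫ a', exp (-s * ‖a'‖ ^ 2) ∂lam := by
    intro x
    rw [← integral_sub_left_eq_self (fun a' : E.direction => exp (-s * ‖a'‖ ^ 2)) lam x.1,
      ← integral_const_mul]
    refine integral_congr_ae (ae_of_all _ fun a' => ?_)
    simp only [gapSq]
    rw [mul_assoc, ← exp_add]
    congr 2
    ring
  simp_rw [h1]
  rw [integral_mul_const, integral_prod_mul F (fun b : E.directionᗮ => exp (-s * ‖b‖ ^ 2)),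
    mul_assoc, integral_gaussian_mul_eq_Bconst hT]

/-! ### Partitions with small second moments -/

theorem lintegral_norm_sub_le_of_second_moment {Z : Type*} [NormedAddCommGroup Z]
    [MeasurableSpace Z] [BorelSpace Z] [SecondCountableTopology Z]
    {μ : Measure Z} {A : Set Z} (hA : MeasurableSet A) (hfin : μ A < ⊤)
    {ε : ℝ} (hε : 0 < ε) {p : Z}
    (hmom : ∫⁻ y in A, ENNReal.ofReal (‖y - p‖ ^ 2) ∂μ ≤ ENNReal.ofReal (ε ^ 2) * μ A) :
    ∫⁻ y in A, ENNReal.ofReal ‖y - p‖ ∂μ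
      ≤ ENNReal.ofReal (2 * ε) * μ (A ∩ {y | ‖y - p‖ ^ 2 < 2 * ε ^ 2}) := by
  have hG : MeasurableSet {y | ‖y - p‖ ^ 2 < 2 * ε ^ 2} :=
    measurableSet_lt (by fun_prop) (by fun_prop)
  have hfirst : ∫⁻ y in A, ENNReal.ofReal ‖y - p‖ ∂μ ≤ ENNReal.ofReal ε * μ A := by
    calc ∫⁻ y in A, ENNReal.ofReal ‖y - p‖ ∂μ
        ≤ ∫⁻ y in A, (ENNReal.ofReal (ε / 2) +
            ENNReal.ofReal (1 / (2 * ε)) * ENNReal.ofReal (‖y - p‖ ^ 2)) ∂μ := by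
          refine lintegral_mono fun y => ?_
          rw [← ENNReal.ofReal_mul (by positivity), ← ENNReal.ofReal_add (by positivity)
            (by positivity)]
          refine ENNReal.ofReal_le_ofReal ?_
          have : ε / 2 + 1 / (2 * ε) * ‖y - p‖ ^ 2 - ‖y - p‖
              = (ε - ‖y - p‖) ^ 2 / (2 * ε) := by field_simp; ring
          have : 0 ≤ (ε - ‖y - p‖) ^ 2 / (2 * ε) := by positivity
          linarith
      _ = ENNReal.ofReal (ε / 2) * μ A + ENNReal.ofReal (1 / (2 * ε)) *
            ∫⁻ y in A, ENNReal.ofReal (‖y - p‖ ^ 2) ∂μ := by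
          rw [lintegral_add_left measurable_const, lintegral_const_mul _ (by fun_prop)]
          simp
      _ ≤ ENNReal.ofReal (ε / 2) * μ A + ENNReal.ofReal (1 / (2 * ε)) *
            (ENNReal.ofReal (ε ^ 2) * μ A) := by gcongr
      _ = ENNReal.ofReal ε * μ A := by
          rw [← mul_assoc, ← add_mul, ← ENNReal.ofReal_mul (by positivity),
            ← ENNReal.ofReal_add (by positivity) (by positivity)]
          congr 2
          field_simp
          ring
  have hsplit := measure_inter_add_sdiff (μ := μ) A hG
  set g := μ (A ∩ {y | ‖y - p‖ ^ 2 < 2 * ε ^ 2})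
  set d := μ (A \ {y | ‖y - p‖ ^ 2 < 2 * ε ^ 2})
  have hcheb : ENNReal.ofReal (2 * ε ^ 2) * d ≤ ENNReal.ofReal (ε ^ 2) * μ A := by
    refine le_trans ?_ hmom
    calc ENNReal.ofReal (2 * ε ^ 2) * d
        = ∫⁻ _ in A \ {y | ‖y - p‖ ^ 2 < 2 * ε ^ 2}, ENNReal.ofReal (2 * ε ^ 2) ∂μ := by simp [d]
      _ ≤ ∫⁻ y in A \ {y | ‖y - p‖ ^ 2 < 2 * ε ^ 2}, ENNReal.ofReal (‖y - p‖ ^ 2) ∂μ := by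
          refine setLIntegral_mono' (hA.diff hG) fun y hy => ENNReal.ofReal_le_ofReal ?_
          simpa using hy.2
      _ ≤ _ := lintegral_mono_set Set.sdiff_subset
  have hhalf : μ A ≤ 2 * g := by
    have h2 : ENNReal.ofReal (ε ^ 2) * (2 * d) ≤ ENNReal.ofReal (ε ^ 2) * μ A := by
      refine le_trans (le_of_eq ?_) hcheb
      rw [ENNReal.ofReal_mul two_pos.le, ENNReal.ofReal_ofNat]
      ring
    have h3 : 2 * d ≤ μ A :=
      (ENNReal.mul_le_mul_iff_right (by simp; positivity) ENNReal.ofReal_ne_top).1 h2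
    have hd : d ≠ ⊤ := ((measure_mono Set.sdiff_subset).trans_lt hfin).ne
    rw [← hsplit, two_mul] at h3
    rw [← hsplit, two_mul]
    exact add_le_add_right (ENNReal.le_of_add_le_add_right hd h3) g
  calc _ ≤ ENNReal.ofReal ε * μ A := hfirst
    _ ≤ ENNReal.ofReal ε * (2 * g) := by gcongr
    _ = ENNReal.ofReal (2 * ε) * g := by
        rw [ENNReal.ofReal_mul two_pos.le, ← mul_assoc, mul_comm (ENNReal.ofReal ε)]
        simp

theorem lintegral_norm_sub_mul_gaussian_le {Z : Type*} [NormedAddCommGroup Z]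
    [MeasurableSpace Z] [BorelSpace Z] [SecondCountableTopology Z]
    {μ : Measure Z} {ι : Type*} [Countable ι] {A : ι → Set Z} {p : ι → Z}
    (hAmeas : ∀ i, MeasurableSet (A i)) (hdisj : Pairwise fun i j => Disjoint (A i) (A j))
    (hcover : (⋃ i, A i) = Set.univ) (hfin : ∀ i, μ (A i) < ⊤)
    {ε : ℝ} (hε : 0 < ε)
    (hmom : ∀ i, ∫⁻ y in A i, ENNReal.ofReal (‖y - p i‖ ^ 2) ∂μ
      ≤ ENNReal.ofReal (ε ^ 2) * μ (A i))
    {q : Z → Z} (hq : ∀ i, ∀ y ∈ A i, q y = p i) {s : ℝ} (hs : 0 < s) (z : Z) :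
    ∫⁻ y, ENNReal.ofReal (‖y - q y‖ * exp (-s * ‖q y - z‖ ^ 2)) ∂μ
      ≤ ENNReal.ofReal (2 * ε * exp (2 * s * ε ^ 2)) *
        ∫⁻ y, ENNReal.ofReal (exp (-(s / 2) * ‖y - z‖ ^ 2)) ∂μ := by
  rw [← setLIntegral_univ, ← hcover, lintegral_iUnion hAmeas hdisj, ← setLIntegral_univ,
    ← hcover, lintegral_iUnion hAmeas hdisj, ← ENNReal.tsum_mul_left]
  refine ENNReal.tsum_le_tsum fun i => ?_
  have hG : MeasurableSet {y | ‖y - p i‖ ^ 2 < 2 * ε ^ 2} :=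
    measurableSet_lt (by fun_prop) (by fun_prop)
  set G := A i ∩ {y | ‖y - p i‖ ^ 2 < 2 * ε ^ 2}
  have hGm : MeasurableSet G := (hAmeas i).inter hG
  calc ∫⁻ y in A i, ENNReal.ofReal (‖y - q y‖ * exp (-s * ‖q y - z‖ ^ 2)) ∂μ
      = ∫⁻ y in A i, ENNReal.ofReal ‖y - p i‖ *
          ENNReal.ofReal (exp (-s * ‖p i - z‖ ^ 2)) ∂μ := by
        refine setLIntegral_congr_fun (hAmeas i) fun y hy => ?_
        simp only [hq i y hy]
        rw [ENNReal.ofReal_mul (norm_nonneg _)]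
    _ = (∫⁻ y in A i, ENNReal.ofReal ‖y - p i‖ ∂μ) *
          ENNReal.ofReal (exp (-s * ‖p i - z‖ ^ 2)) := lintegral_mul_const _ (by fun_prop)
    _ ≤ ENNReal.ofReal (2 * ε) * μ G * ENNReal.ofReal (exp (-s * ‖p i - z‖ ^ 2)) := by
        gcongr
        exact lintegral_norm_sub_le_of_second_moment (hAmeas i) (hfin i) hε (hmom i)
    _ = ENNReal.ofReal (2 * ε) * ∫⁻ _ in G, ENNReal.ofReal (exp (-s * ‖p i - z‖ ^ 2)) ∂μ := by
        rw [setLIntegral_const]; ring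
    _ ≤ ENNReal.ofReal (2 * ε) * ∫⁻ y in G, ENNReal.ofReal (exp (2 * s * ε ^ 2)) *
          ENNReal.ofReal (exp (-(s / 2) * ‖y - z‖ ^ 2)) ∂μ := by
        gcongr ENNReal.ofReal (2 * ε) * ?_
        refine setLIntegral_mono' hGm fun y hy => ?_
        rw [← ENNReal.ofReal_mul (exp_pos _).le, ← exp_add]
        refine ENNReal.ofReal_le_ofReal (exp_le_exp.2 ?_)
        have h1 : ‖y - p i‖ ^ 2 < 2 * ε ^ 2 := hy.2
        have h2 : ‖y - z‖ ≤ ‖y - p i‖ + ‖p i - z‖ := norm_sub_le_norm_sub_add_norm_sub _ _ _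
        have h3 : ‖y - z‖ ^ 2 ≤ 4 * ε ^ 2 + 2 * ‖p i - z‖ ^ 2 := by
          have := pow_le_pow_left₀ (norm_nonneg _) h2 2
          nlinarith [sq_nonneg (‖y - p i‖ - ‖p i - z‖)]
        nlinarith
    _ = ENNReal.ofReal (2 * ε * exp (2 * s * ε ^ 2)) *
          ∫⁻ y in G, ENNReal.ofReal (exp (-(s / 2) * ‖y - z‖ ^ 2)) ∂μ := by
        rw [lintegral_const_mul _ (by fun_prop), ← mul_assoc,
          ← ENNReal.ofReal_mul (by positivity)]
    _ ≤ _ := by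
        gcongr
        exact Set.inter_subset_left

/-- The discrete measure of a partition is the push-forward under the map sending each
cell to its node. -/
theorem exists_measurable_sum_dirac_eq_map {Z : Type*} [MeasurableSpace Z]
    (μ : Measure Z) {ι : Type*} [Countable ι] {A : ι → Set Z} {p : ι → Z}
    (hAmeas : ∀ i, MeasurableSet (A i)) (hdisj : Pairwise fun i j => Disjoint (A i) (A j))
    (hcover : (⋃ i, A i) = Set.univ) :
    ∃ q : Z → Z, Measurable q ∧ (∀ i, ∀ y ∈ A i, q y = p i) ∧
      (Measure.sum fun i => μ (A i) • Measure.dirac (p i)) = μ.map q := by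
  have hex : ∀ y, ∃ i, y ∈ A i := fun y => by
    have : y ∈ ⋃ i, A i := hcover ▸ Set.mem_univ y
    simpa using this
  choose idx hidx using hex
  have hq : ∀ i, ∀ y ∈ A i, p (idx y) = p i := fun i y hy => by
    by_contra hne
    have hij : idx y ≠ i := fun h => hne (by rw [h])
    exact Set.disjoint_left.1 (hdisj hij) (hidx y) hy
  have hqm : Measurable fun y => p (idx y) := by
    intro S _
    have : (fun y => p (idx y)) ⁻¹' S = ⋃ i ∈ {i | p i ∈ S}, A i := by
      ext y
      simp only [Set.mem_preimage, Set.mem_iUnion, Set.mem_ofPred_eq, exists_prop]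
      constructor
      · exact fun h => ⟨idx y, h, hidx y⟩
      · rintro ⟨i, hi, hy⟩
        rwa [hq i y hy]
    rw [this]
    exact MeasurableSet.biUnion (Set.to_countable _) fun i _ => hAmeas i
  refine ⟨fun y => p (idx y), hqm, hq, ?_⟩
  have hμ : μ = Measure.sum fun i => μ.restrict (A i) := by
    rw [← Measure.restrict_iUnion hdisj hAmeas, hcover, Measure.restrict_univ]
  conv_rhs => rw [hμ, Measure.map_sum hqm.aemeasurable]
  congr 1
  funext i
  have : (fun y => p (idx y)) =ᵐ[μ.restrict (A i)] fun _ => p i :=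
    (ae_restrict_iff' (hAmeas i)).2 (ae_of_all _ fun y hy => hq i y hy)
  rw [Measure.map_congr this, Measure.map_const, Measure.restrict_apply_univ]

/-! ### Pointwise estimates -/

theorem abs_sub_le_of_lipschitzWith_inv {α : Type*} [PseudoMetricSpace α] {ℓ : ℝ} (hℓ : 0 < ℓ)
    {f : α → ℝ} (hf : LipschitzWith (Real.toNNReal ℓ)⁻¹ f) (q q' : α) :
    |f q - f q'| ≤ 1 / ℓ * dist q q' := by
  have h := hf.dist_le_mul q q'
  rwa [Real.dist_eq, NNReal.coe_inv, Real.coe_toNNReal _ hℓ.le, ← one_div] at h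

theorem abs_discretization_integrand_le {Z : Type*} [NormedAddCommGroup Z]
    {ℓ β ε Cb cstar : ℝ} (hℓ : 0 < ℓ) (hβ : 1 ≤ β) (hβε : β * ε ^ 2 ≤ Cb) (hcstar : 1 ≤ cstar)
    {f : Z × Z → ℝ} (hf1 : ∀ q, |f q| ≤ 1) (hf : LipschitzWith (Real.toNNReal ℓ)⁻¹ f)
    {p y z : Z} (hcell : ‖p - z‖ ^ 2 ≤ cstar ^ 2 * (ε ^ 2 + ‖y - z‖ ^ 2)) :
    |f (p, z) * exp (-β * ‖p - z‖ ^ 2) - f (y, z) * exp (-β * ‖y - z‖ ^ 2)|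
      ≤ (1 / ℓ + 2 * exp (Cb / 2)) * √β *
        (‖y - p‖ * exp (-(1 / (2 * cstar ^ 2) * β) * ‖p - z‖ ^ 2)) := by
  have hβ0 : 0 < β := by linarith
  have hCb : 0 ≤ Cb := le_trans (by positivity) hβε
  have hc0 : 0 < cstar := by linarith
  have hc2 : 1 ≤ cstar ^ 2 := one_le_pow₀ hcstar
  set G := exp (-(1 / (2 * cstar ^ 2) * β) * ‖p - z‖ ^ 2) with hGdef
  have hκ : 1 / (2 * cstar ^ 2) * β * ‖p - z‖ ^ 2 ≤ β * ‖p - z‖ ^ 2 / 2 := by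
    have : 1 / (2 * cstar ^ 2) ≤ 1 / 2 := by
      apply one_div_le_one_div_of_le two_pos; linarith
    nlinarith [mul_nonneg hβ0.le (sq_nonneg ‖p - z‖)]
  have hG1 : exp (-(β * ‖p - z‖ ^ 2 / 2)) ≤ G := exp_le_exp.2 (by linarith)
  have hGfull : exp (-β * ‖p - z‖ ^ 2) ≤ G :=
    exp_le_exp.2 (by nlinarith [mul_nonneg hβ0.le (sq_nonneg ‖p - z‖)])
  have hGp : exp (-(β * ‖p - z‖ ^ 2 / 2)) ≤ exp (Cb / 2) * G := by
    have : 1 ≤ exp (Cb / 2) := one_le_exp (by positivity)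
    nlinarith [exp_pos (-(1 / (2 * cstar ^ 2) * β) * ‖p - z‖ ^ 2)]
  have hGy : exp (-(β * ‖y - z‖ ^ 2 / 2)) ≤ exp (Cb / 2) * G := by
    rw [hGdef, ← exp_add]
    apply exp_le_exp.2
    have h1 : 1 / (2 * cstar ^ 2) * ‖p - z‖ ^ 2 ≤ (ε ^ 2 + ‖y - z‖ ^ 2) / 2 := by
      rw [div_mul_eq_mul_div, one_mul, div_le_div_iff₀ (by positivity) two_pos]
      nlinarith
    nlinarith
  have hexp := abs_exp_neg_mul_sq_sub_le hβ0 (norm_nonneg (p - z)) (norm_nonneg (y - z)) hGp hGy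
  have hrs : |‖p - z‖ - ‖y - z‖| ≤ ‖y - p‖ := by
    have := abs_norm_sub_norm_le (p - z) (y - z)
    rwa [sub_sub_sub_cancel_right, norm_sub_rev p y] at this
  have hlip : |f (p, z) - f (y, z)| ≤ 1 / ℓ * ‖y - p‖ := by
    have := abs_sub_le_of_lipschitzWith_inv hℓ hf (p, z) (y, z)
    rwa [Prod.dist_eq, dist_self, max_eq_left dist_nonneg, dist_comm, dist_eq_norm] at this
  have hsβ : 1 ≤ √β := one_le_sqrt.2 hβ
  calc |f (p, z) * exp (-β * ‖p - z‖ ^ 2) - f (y, z) * exp (-β * ‖y - z‖ ^ 2)|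
      = |(f (p, z) - f (y, z)) * exp (-β * ‖p - z‖ ^ 2)
          + f (y, z) * (exp (-β * ‖p - z‖ ^ 2) - exp (-β * ‖y - z‖ ^ 2))| := by ring_nf
    _ ≤ |f (p, z) - f (y, z)| * exp (-β * ‖p - z‖ ^ 2)
          + |f (y, z)| * |exp (-β * ‖p - z‖ ^ 2) - exp (-β * ‖y - z‖ ^ 2)| := by
        refine (abs_add_le _ _).trans (le_of_eq ?_)
        rw [abs_mul, abs_mul, abs_exp]
    _ ≤ 1 / ℓ * ‖y - p‖ * G + 1 * (2 * √β * (exp (Cb / 2) * G) * ‖y - p‖) := by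
        gcongr
        · exact hf1 _
        · exact hexp.trans (by gcongr)
    _ = 1 / ℓ * 1 * ‖y - p‖ * G + 2 * exp (Cb / 2) * √β * (‖y - p‖ * G) := by ring
    _ ≤ 1 / ℓ * √β * ‖y - p‖ * G + 2 * exp (Cb / 2) * √β * (‖y - p‖ * G) := by gcongr
    _ = _ := by ring

theorem exp_neg_le_of_transversal {N : ℕ} {E : AffineSubspace ℝ (ZZ N)} {Φ : ZZ N → ℝ}
    {β₀ c b : ℝ} (hc : 0 < c)
    (htrans : ∀ y : ZZ N, ∀ z ∈ E, c * (‖y‖ ^ 2 + ‖z‖ ^ 2) - b ≤ β₀ * ‖y - z‖ ^ 2 + Φ y)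
    {ξ : ZZ N} (hξ : ξ ∈ E) (η : ZZ N) :
    exp (-Φ (ξ + η)) ≤ exp b * exp (-c * ‖ξ‖ ^ 2) * exp (β₀ * ‖η‖ ^ 2) := by
  rw [← exp_add, ← exp_add]
  apply exp_le_exp.2
  have h := htrans (ξ + η) ξ hξ
  rw [add_sub_cancel_left] at h
  nlinarith [mul_nonneg hc.le (sq_nonneg ‖ξ + η‖)]

theorem abs_exp_neg_sub_le_of_growth {N : ℕ} {E : AffineSubspace ℝ (ZZ N)} {Φ : ZZ N → ℝ}
    {β₀ c b : ℝ} (hβ₀ : 0 < β₀) (hc : 0 < c)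
    (htrans : ∀ y : ZZ N, ∀ z ∈ E, c * (‖y‖ ^ 2 + ‖z‖ ^ 2) - b ≤ β₀ * ‖y - z‖ ^ 2 + Φ y)
    {C γ U : ℝ} (hC : 0 < C) (hγ : 0 ≤ γ)
    {ξ : ZZ N} (hξ : ξ ∈ E)
    (hC1 : ContDiff ℝ 1 (fun η : E.directionᗮ => Φ (ξ + η)))
    (hgrowth : ∀ η : E.directionᗮ,
      ‖fderiv ℝ (fun η' : E.directionᗮ => Φ (ξ + η')) η‖ ≤ C * (1 + U + ‖η‖ ^ γ))
    (η : E.directionᗮ) :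
    |exp (-Φ (ξ + η)) - exp (-Φ ξ)| ≤
      exp b * exp (-c * ‖ξ‖ ^ 2) * exp (β₀ * ‖η‖ ^ 2) * (C * (1 + U + ‖η‖ ^ γ)) * ‖η‖ := by
  have hdiff : ∀ x : E.directionᗮ, HasFDerivAt (fun η : E.directionᗮ => exp (-Φ (ξ + η)))
      (exp (-Φ (ξ + x)) • -fderiv ℝ (fun η' : E.directionᗮ => Φ (ξ + η')) x) x := fun x =>
    ((hC1.differentiable one_ne_zero x).hasFDerivAt.fun_neg).exp
  have key := (convex_closedBall (0 : E.directionᗮ) ‖η‖).norm_image_sub_le_of_norm_hasFDerivWithin_le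
    (f := fun η : E.directionᗮ => exp (-Φ (ξ + η))) (x := 0) (y := η)
    (C := exp b * exp (-c * ‖ξ‖ ^ 2) * exp (β₀ * ‖η‖ ^ 2) * (C * (1 + U + ‖η‖ ^ γ)))
    (fun x _ => (hdiff x).hasFDerivWithinAt) ?_ (by simp) (by simp)
  · simpa using key
  · intro x hx
    have hx' : ‖x‖ ≤ ‖η‖ := by simpa using hx
    rw [norm_smul, norm_neg, norm_eq_abs, abs_exp]
    have h1 := exp_neg_le_of_transversal hc htrans hξ (x : ZZ N)
    have h1' : exp (-Φ (ξ + x)) ≤ exp b * exp (-c * ‖ξ‖ ^ 2) * exp (β₀ * ‖η‖ ^ 2) := by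
      have hx'' : ‖(x : ZZ N)‖ ≤ ‖η‖ := hx'
      exact h1.trans (by gcongr)
    have h2 : ‖fderiv ℝ (fun η' : E.directionᗮ => Φ (ξ + η')) x‖ ≤ C * (1 + U + ‖η‖ ^ γ) := by
      refine (hgrowth x).trans ?_
      gcongr
    gcongr

theorem abs_thermalization_integrand_le {N : ℕ} {E : AffineSubspace ℝ (ZZ N)} {Φ : ZZ N → ℝ}
    {β₀ c b : ℝ} (hβ₀ : 0 < β₀) (hc : 0 < c)
    (htrans : ∀ y : ZZ N, ∀ z ∈ E, c * (‖y‖ ^ 2 + ‖z‖ ^ 2) - b ≤ β₀ * ‖y - z‖ ^ 2 + Φ y)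
    {C γ U : ℝ} (hC : 0 < C) (hγ : 0 ≤ γ) (hU : 0 ≤ U)
    {ξ z : ZZ N} (hξ : ξ ∈ E)
    (hC1 : ContDiff ℝ 1 (fun η : E.directionᗮ => Φ (ξ + η)))
    (hgrowth : ∀ η : E.directionᗮ,
      ‖fderiv ℝ (fun η' : E.directionᗮ => Φ (ξ + η')) η‖ ≤ C * (1 + U + ‖η‖ ^ γ))
    {ℓ : ℝ} (hℓ : 0 < ℓ) {f : ZZ N × ZZ N → ℝ} (hf1 : ∀ q, |f q| ≤ 1)
    (hf : LipschitzWith (Real.toNNReal ℓ)⁻¹ f)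
    {K : ℝ} (hK : ∀ β R : ℝ, 1 ≤ β → 0 ≤ R → R ^ γ * exp (-(β * R ^ 2 / 4)) ≤ K)
    {β : ℝ} (hβ : 1 ≤ β) (hββ₀ : 4 * β₀ ≤ β)
    (η : E.directionᗮ) {R : ℝ} (hR : 0 ≤ R) (hηR : ‖η‖ ≤ R) (hzR : ‖z - ξ‖ ≤ R) :
    |f (ξ + η, z) * exp (-Φ (ξ + η)) - f (ξ, ξ) * exp (-Φ ξ)| * exp (-β * R ^ 2)
      ≤ 1 / √β * (exp b * exp (-c * ‖ξ‖ ^ 2) * (1 / ℓ + C * (1 + K) + C * U)) *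
        exp (-(β / 4) * R ^ 2) := by
  have hβ0 : 0 < β := by linarith
  set g := exp b * exp (-c * ‖ξ‖ ^ 2) with hg
  have hg0 : 0 < g := by positivity
  have h1 : exp (-Φ (ξ + η)) ≤ g * exp (β₀ * R ^ 2) := by
    refine (exp_neg_le_of_transversal hc htrans hξ (η : ZZ N)).trans ?_
    have : ‖(η : ZZ N)‖ ≤ R := hηR
    gcongr
  have h2 : |exp (-Φ (ξ + η)) - exp (-Φ ξ)| ≤ g * exp (β₀ * R ^ 2) * (C * (1 + U + R ^ γ)) * R := by
    refine (abs_exp_neg_sub_le_of_growth hβ₀ hc htrans hC hγ hξ hC1 hgrowth η).trans ?_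
    gcongr
  have h3 : |f (ξ + η, z) - f (ξ, ξ)| ≤ 1 / ℓ * R := by
    refine (abs_sub_le_of_lipschitzWith_inv hℓ hf _ _).trans ?_
    gcongr
    rw [Prod.dist_eq]
    refine max_le ?_ (by simpa [dist_eq_norm] using hzR)
    simpa [dist_eq_norm] using hηR
  have h4 : |f (ξ + η, z) * exp (-Φ (ξ + η)) - f (ξ, ξ) * exp (-Φ ξ)|
      ≤ g * exp (β₀ * R ^ 2) * R * (1 / ℓ + C * (1 + U) + C * R ^ γ) := by
    calc |f (ξ + η, z) * exp (-Φ (ξ + η)) - f (ξ, ξ) * exp (-Φ ξ)|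
        = |(f (ξ + η, z) - f (ξ, ξ)) * exp (-Φ (ξ + η))
            + f (ξ, ξ) * (exp (-Φ (ξ + η)) - exp (-Φ ξ))| := by ring_nf
      _ ≤ |f (ξ + η, z) - f (ξ, ξ)| * exp (-Φ (ξ + η))
            + |f (ξ, ξ)| * |exp (-Φ (ξ + η)) - exp (-Φ ξ)| := by
          refine (abs_add_le _ _).trans (le_of_eq ?_)
          rw [abs_mul, abs_mul, abs_exp]
      _ ≤ 1 / ℓ * R * (g * exp (β₀ * R ^ 2))
            + 1 * (g * exp (β₀ * R ^ 2) * (C * (1 + U + R ^ γ)) * R) := by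
          gcongr
          exact hf1 _
      _ = _ := by ring
  set e := exp (-(β * R ^ 2 / 4)) with he
  have he0 : 0 < e := exp_pos _
  have he1 : e ≤ 1 := exp_le_one_iff.2 (by
    have : 0 ≤ β * R ^ 2 / 4 := by positivity
    linarith)
  have hRe : R * e ≤ 1 / √β := mul_exp_neg_sq_div_four_le hβ0
  have hRγ : R ^ γ * e ≤ K := hK β R hβ hR
  have hsplit : exp (β₀ * R ^ 2) * exp (-β * R ^ 2) ≤ e * e * e := by
    rw [he, ← exp_add, ← exp_add, ← exp_add]
    apply exp_le_exp.2
    nlinarith [sq_nonneg R]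
  have he4 : exp (-(β / 4) * R ^ 2) = e := by rw [he]; congr 1; ring
  rw [he4]
  have hRγ0 : 0 ≤ R ^ γ := rpow_nonneg hR γ
  have hL : 0 ≤ 1 / ℓ + C * (1 + U) := by positivity
  calc |f (ξ + η, z) * exp (-Φ (ξ + η)) - f (ξ, ξ) * exp (-Φ ξ)| * exp (-β * R ^ 2)
      ≤ g * exp (β₀ * R ^ 2) * R * (1 / ℓ + C * (1 + U) + C * R ^ γ) * exp (-β * R ^ 2) := by
        gcongr
    _ = g * R * (1 / ℓ + C * (1 + U) + C * R ^ γ) * (exp (β₀ * R ^ 2) * exp (-β * R ^ 2)) := by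
        ring
    _ ≤ g * R * (1 / ℓ + C * (1 + U) + C * R ^ γ) * (e * e * e) := by gcongr
    _ = (R * e) * (g * ((1 / ℓ + C * (1 + U)) * e + C * (R ^ γ * e))) * e := by ring
    _ ≤ 1 / √β * (g * ((1 / ℓ + C * (1 + U)) * 1 + C * K)) * e := by gcongr
    _ = _ := by ring

/-! ### The two error contributions -/

theorem sFinite_muE {N : ℕ} {E : AffineSubspace ℝ (ZZ N)} (hE : (E : Set (ZZ N)).Nonempty)
    (hdim : Module.finrank ℝ E.direction = N) : SFinite (muE N E) := by
  obtain ⟨x₀, hx₀⟩ := hE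
  have := isAddHaarMeasure_hausdorffMeasure_direction E hdim
  rw [muE_eq_map E hx₀]
  infer_instance

theorem sFinite_muD {N : ℕ} (Φ : ZZ N → ℝ) : SFinite (muD N Φ) := by
  unfold muD
  infer_instance

theorem measurePreserving_orthoCoord {N : ℕ} {E : AffineSubspace ℝ (ZZ N)} {x₀ : ZZ N}
    (hx₀ : x₀ ∈ E) (hdim : Module.finrank ℝ E.direction = N)
    {τ : Measure E.directionᗮ} [SFinite τ]
    (hT : MeasurePreserving
      (fun t : E.direction × E.directionᗮ => x₀ + (t.1 : ZZ N) + (t.2 : ZZ N))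
      ((μH[(N : ℝ)] : Measure E.direction).prod τ) volume) :
    MeasurePreserving (orthoCoord E x₀)
      (((μH[(N : ℝ)] : Measure E.direction).prod τ).prod (μH[(N : ℝ)] : Measure E.direction))
      (volume.prod (muE N E)) := by
  have := isAddHaarMeasure_hausdorffMeasure_direction E hdim
  have := sFinite_muE ⟨x₀, hx₀⟩ hdim
  exact hT.prod ⟨by fun_prop, (muE_eq_map E hx₀).symm⟩

theorem muD_prod_muE {N : ℕ} {E : AffineSubspace ℝ (ZZ N)} [SFinite (muE N E)]
    {Φ : ZZ N → ℝ} (hΦ : Measurable Φ) :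
    (muD N Φ).prod (muE N E) =
      (volume.prod (muE N E)).withDensity fun q => ENNReal.ofReal (exp (-Φ q.1)) :=
  prod_withDensity_left (by fun_prop)

theorem lintegral_muD_prod_muE {N : ℕ} {E : AffineSubspace ℝ (ZZ N)} [SFinite (muE N E)]
    {x₀ : ZZ N} {Φ : ZZ N → ℝ} (hΦ : Measurable Φ)
    {M : Measure ((E.direction × E.directionᗮ) × E.direction)}
    (hJ : MeasurePreserving (orthoCoord E x₀) M (volume.prod (muE N E)))
    {g : ZZ N × ZZ N → ENNReal} (hg : Measurable g) :
    ∫⁻ q, g q ∂((muD N Φ).prod (muE N E)) =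
      ∫⁻ t, ENNReal.ofReal (exp (-Φ (orthoCoord E x₀ t).1)) * g (orthoCoord E x₀ t) ∂M := by
  rw [muD_prod_muE hΦ, lintegral_withDensity_eq_lintegral_mul _ (by fun_prop) hg,
    ← hJ.lintegral_comp (by fun_prop)]
  rfl

theorem integral_muD_prod_muE {N : ℕ} {E : AffineSubspace ℝ (ZZ N)} [SFinite (muE N E)]
    {x₀ : ZZ N} {Φ : ZZ N → ℝ} (hΦ : Measurable Φ)
    {M : Measure ((E.direction × E.directionᗮ) × E.direction)}
    (hJ : MeasurePreserving (orthoCoord E x₀) M (volume.prod (muE N E)))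
    {g : ZZ N × ZZ N → ℝ} (hg : Measurable g) :
    ∫ q, g q ∂((muD N Φ).prod (muE N E)) =
      ∫ t, exp (-Φ (orthoCoord E x₀ t).1) * g (orthoCoord E x₀ t) ∂M := by
  rw [muD_prod_muE hΦ, integral_withDensity_eq_integral_toReal_smul (by fun_prop)
    (ae_of_all _ fun _ => ENNReal.ofReal_lt_top), ← hJ.map_eq,
    integral_map hJ.aemeasurable (by fun_prop)]
  simp only [ENNReal.toReal_ofReal (exp_pos _).le, smul_eq_mul]

theorem integrable_muD_prod_muE_iff {N : ℕ} {E : AffineSubspace ℝ (ZZ N)} [SFinite (muE N E)]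
    {x₀ : ZZ N} {Φ : ZZ N → ℝ} (hΦ : Measurable Φ)
    {M : Measure ((E.direction × E.directionᗮ) × E.direction)}
    (hJ : MeasurePreserving (orthoCoord E x₀) M (volume.prod (muE N E)))
    {g : ZZ N × ZZ N → ℝ} (hg : Measurable g) :
    Integrable g ((muD N Φ).prod (muE N E)) ↔
      Integrable (fun t => exp (-Φ (orthoCoord E x₀ t).1) * g (orthoCoord E x₀ t)) M := by
  rw [muD_prod_muE hΦ, integrable_withDensity_iff_integrable_smul' (by fun_prop)
    (ae_of_all _ fun _ => ENNReal.ofReal_lt_top), ← hJ.map_eq,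
    integrable_map_measure (by fun_prop) hJ.aemeasurable]
  simp only [ENNReal.toReal_ofReal (exp_pos _).le, smul_eq_mul, Function.comp_def]

theorem integral_therm_map_prod {N : ℕ} {μ ν : Measure (ZZ N)} [SFinite μ] [SFinite ν]
    {q : ZZ N → ZZ N} (hq : Measurable q) {β : ℝ} (hβ : 0 < β)
    {f : ZZ N × ZZ N → ℝ} (hf : Measurable f) :
    ∫ x, f x ∂(therm ((μ.map q).prod ν) β) =
      ∫ x, (Bconst N β)⁻¹ * (f (q x.1, x.2) * exp (-β * ‖q x.1 - x.2‖ ^ 2)) ∂(μ.prod ν) := by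
  have hmap : (μ.map q).prod ν = (μ.prod ν).map (Prod.map q id) := by
    rw [← Measure.map_prod_map _ _ hq measurable_id, Measure.map_id]
  have hB : 0 ≤ (Bconst N β)⁻¹ := (inv_pos.2 (Bconst_pos hβ)).le
  rw [therm, integral_withDensity_eq_integral_toReal_smul (by fun_prop)
    (ae_of_all _ fun _ => ENNReal.ofReal_lt_top), hmap,
    integral_map (by fun_prop) (by fun_prop)]
  refine integral_congr_ae (ae_of_all _ fun x => ?_)
  simp only [id_eq, smul_eq_mul, Prod.map_apply']
  rw [ENNReal.toReal_ofReal (mul_nonneg hB (exp_pos _).le)]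
  ring

/-- The thermalized continuous measure has uniformly bounded mass. -/
theorem lintegral_gaussian_muD_prod_muE_le {N : ℕ} {E : AffineSubspace ℝ (ZZ N)} {x₀ : ZZ N}
    (hx₀ : x₀ ∈ E) (hdim : Module.finrank ℝ E.direction = N)
    {τ : Measure E.directionᗮ} [SFinite τ]
    (hT : MeasurePreserving
      (fun t : E.direction × E.directionᗮ => x₀ + (t.1 : ZZ N) + (t.2 : ZZ N))
      ((μH[(N : ℝ)] : Measure E.direction).prod τ) volume)
    {Φ : ZZ N → ℝ} (hΦ : Measurable Φ) {β₀ c b : ℝ} (hβ₀ : 0 < β₀) (hc : 0 < c)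
    (htrans : ∀ y : ZZ N, ∀ z ∈ E, c * (‖y‖ ^ 2 + ‖z‖ ^ 2) - b ≤ β₀ * ‖y - z‖ ^ 2 + Φ y)
    {s : ℝ} (hs : 2 * β₀ ≤ s) :
    ∫⁻ q, ENNReal.ofReal (exp (-s * ‖q.1 - q.2‖ ^ 2)) ∂((muD N Φ).prod (muE N E)) ≤
      (∫⁻ a : E.direction, ENNReal.ofReal (exp b * exp (-c * ‖x₀ + (a : ZZ N)‖ ^ 2))
        ∂(μH[(N : ℝ)] : Measure E.direction)) * ENNReal.ofReal (Bconst N (1 / 2 * s)) := by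
  have := isAddHaarMeasure_hausdorffMeasure_direction E hdim
  have := sFinite_muE ⟨x₀, hx₀⟩ hdim
  have hs0 : 0 < s := by linarith
  have hJ := measurePreserving_orthoCoord hx₀ hdim hT
  have hJm := measurable_orthoCoord E x₀
  rw [lintegral_muD_prod_muE hΦ hJ (by fun_prop)]
  refine lintegral_le_mul_Bconst hT (by positivity) _ (by fun_prop) _ fun t => ?_
  rw [← ENNReal.ofReal_mul (exp_pos _).le, ← ENNReal.ofReal_mul (by positivity),
    norm_sq_orthoCoord_sub]
  refine ENNReal.ofReal_le_ofReal ?_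
  have h := exp_neg_le_of_transversal hc htrans (add_mem_of_mem_direction hx₀ t.1.1)
    (t.1.2 : ZZ N)
  have h2 : exp (β₀ * ‖(t.1.2 : ZZ N)‖ ^ 2) * exp (-s * gapSq t)
      ≤ exp (-(1 / 2 * s) * gapSq t) := by
    rw [← exp_add]
    apply exp_le_exp.2
    have h3 : ‖(t.1.2 : ZZ N)‖ ^ 2 ≤ gapSq t := le_add_of_nonneg_right (sq_nonneg _)
    nlinarith [sq_nonneg ‖(t.1.2 : ZZ N)‖]
  calc exp (-Φ (orthoCoord E x₀ t).1) * exp (-s * gapSq t)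
      ≤ exp b * exp (-c * ‖x₀ + (t.1.1 : ZZ N)‖ ^ 2) * exp (β₀ * ‖(t.1.2 : ZZ N)‖ ^ 2) *
        exp (-s * gapSq t) := by gcongr; exact h
    _ ≤ _ := by rw [mul_assoc]; gcongr

/-- Discretization error before evaluating the Gaussian mass. -/
theorem lintegral_discretization_le {N : ℕ} {E : AffineSubspace ℝ (ZZ N)} [SFinite (muE N E)]
    {Φ : ZZ N → ℝ} {ι : Type*} [Countable ι] {A : ι → Set (ZZ N)} {p : ι → ZZ N}
    (hAmeas : ∀ i, MeasurableSet (A i)) (hdisj : Pairwise fun i j => Disjoint (A i) (A j))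
    (hcover : (⋃ i, A i) = Set.univ) (hfin : ∀ i, (muD N Φ) (A i) < ⊤)
    {ℓ β ε Cb cstar : ℝ} (hℓ : 0 < ℓ) (hβ : 1 ≤ β) (hε : 0 < ε) (hβε : β * ε ^ 2 ≤ Cb)
    (hcstar : 1 ≤ cstar)
    (hmom : ∀ i, ∫⁻ y in A i, ENNReal.ofReal (‖y - p i‖ ^ 2) ∂(muD N Φ)
      ≤ ENNReal.ofReal (ε ^ 2) * (muD N Φ) (A i))
    (hcell : ∀ i, ∀ z ∈ E, ∀ y ∈ A i,
      ‖p i - z‖ ^ 2 ≤ cstar ^ 2 * (ε ^ 2 + ‖y - z‖ ^ 2))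
    {q : ZZ N → ZZ N} (hqm : Measurable q) (hq : ∀ i, ∀ y ∈ A i, q y = p i)
    {f : ZZ N × ZZ N → ℝ} (hf1 : ∀ x, |f x| ≤ 1) (hf : LipschitzWith (Real.toNNReal ℓ)⁻¹ f) :
    ∫⁻ x, ‖f (q x.1, x.2) * exp (-β * ‖q x.1 - x.2‖ ^ 2)
        - f x * exp (-β * ‖x.1 - x.2‖ ^ 2)‖ₑ ∂((muD N Φ).prod (muE N E)) ≤
      ENNReal.ofReal ((1 / ℓ + 2 * exp (Cb / 2)) * √β * (2 * ε * exp Cb)) *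
        ∫⁻ x, ENNReal.ofReal (exp (-(1 / (4 * cstar ^ 2) * β) * ‖x.1 - x.2‖ ^ 2))
          ∂((muD N Φ).prod (muE N E)) := by
  have := sFinite_muD Φ
  have hfm : Measurable f := hf.continuous.measurable
  have hEm : MeasurableSet (E : Set (ZZ N)) := E.closed_of_finiteDimensional.measurableSet
  have hCb : 0 ≤ Cb := le_trans (by positivity) hβε
  have hc0 : 0 < cstar := by linarith
  have hβ0 : 0 < β := by linarith
  set κ := 1 / (2 * cstar ^ 2) with hκdef
  have hκ0 : 0 < κ := by positivity
  have hκ1 : κ ≤ 1 / 2 := by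
    have : 1 ≤ cstar ^ 2 := one_le_pow₀ hcstar
    exact one_div_le_one_div_of_le two_pos (by linarith)
  set L := (1 / ℓ + 2 * exp (Cb / 2)) * √β with hL
  have hL0 : 0 ≤ L := by positivity
  rw [lintegral_prod_symm' _ (by fun_prop), lintegral_prod_symm' _ (by fun_prop),
    ← lintegral_const_mul' _ _ ENNReal.ofReal_ne_top]
  refine setLIntegral_mono' hEm fun z hz => ?_
  calc ∫⁻ y, ‖f (q y, z) * exp (-β * ‖q y - z‖ ^ 2) - f (y, z) * exp (-β * ‖y - z‖ ^ 2)‖ₑ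
        ∂(muD N Φ)
      ≤ ∫⁻ y, ENNReal.ofReal L *
          ENNReal.ofReal (‖y - q y‖ * exp (-(κ * β) * ‖q y - z‖ ^ 2)) ∂(muD N Φ) := by
        refine lintegral_mono fun y => ?_
        obtain ⟨i, hi⟩ := Set.mem_iUnion.1 (hcover ▸ Set.mem_univ y : y ∈ ⋃ i, A i)
        rw [← ENNReal.ofReal_mul hL0, ← ofReal_norm, norm_eq_abs, hq i y hi]
        exact ENNReal.ofReal_le_ofReal
          (abs_discretization_integrand_le hℓ hβ hβε hcstar hf1 hf (hcell i z hz y hi))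
    _ = ENNReal.ofReal L *
          ∫⁻ y, ENNReal.ofReal (‖y - q y‖ * exp (-(κ * β) * ‖q y - z‖ ^ 2)) ∂(muD N Φ) :=
        lintegral_const_mul _ (by fun_prop)
    _ ≤ ENNReal.ofReal L * (ENNReal.ofReal (2 * ε * exp (2 * (κ * β) * ε ^ 2)) *
          ∫⁻ y, ENNReal.ofReal (exp (-(κ * β / 2) * ‖y - z‖ ^ 2)) ∂(muD N Φ)) := by
        gcongr
        exact lintegral_norm_sub_mul_gaussian_le hAmeas hdisj hcover hfin hε hmom hq
          (by positivity) z
    _ ≤ ENNReal.ofReal L * (ENNReal.ofReal (2 * ε * exp Cb) *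
          ∫⁻ y, ENNReal.ofReal (exp (-(κ * β / 2) * ‖y - z‖ ^ 2)) ∂(muD N Φ)) := by
        gcongr
        nlinarith [mul_nonneg hβ0.le (sq_nonneg ε)]
    _ = _ := by
        rw [← mul_assoc, ← ENNReal.ofReal_mul hL0]
        congr 1
        refine lintegral_congr fun y => ?_
        congr 4
        rw [hκdef]
        field_simp
        norm_num

theorem lintegral_gaussian_shift_lt_top {N : ℕ} {E : AffineSubspace ℝ (ZZ N)} (x₀ : ZZ N)
    {lam : Measure E.direction} [lam.IsAddHaarMeasure] {c : ℝ} (hc : 0 < c) (D : ℝ) :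
    ∫⁻ a : E.direction, ENNReal.ofReal (D * exp (-c * ‖x₀ + (a : ZZ N)‖ ^ 2)) ∂lam < ⊤ := by
  have h := (integrable_exp_neg_mul_sq_norm lam (half_pos hc)).const_mul
    (|D| * exp (c * ‖x₀‖ ^ 2))
  refine lt_of_le_of_lt (lintegral_mono fun a => ?_) h.2
  rw [enorm_of_nonneg (by positivity)]
  refine ENNReal.ofReal_le_ofReal ?_
  beta_reduce
  rw [mul_assoc, ← exp_add]
  refine mul_le_mul (le_abs_self D) (exp_le_exp.2 ?_) (exp_pos _).le (abs_nonneg D)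
  have h1 : ‖a‖ ≤ ‖x₀ + (a : ZZ N)‖ + ‖x₀‖ := by
    have := norm_sub_le (x₀ + (a : ZZ N)) x₀
    rwa [add_sub_cancel_left] at this
  have h2 := pow_le_pow_left₀ (norm_nonneg a) h1 2
  nlinarith [sq_nonneg (‖x₀ + (a : ZZ N)‖ - ‖x₀‖)]

theorem integrable_and_abs_integral_sub_le {α : Type*} [MeasurableSpace α] {μ : Measure α}
    {g h : α → ℝ} (hg : Integrable g μ) (hh : AEStronglyMeasurable h μ) {D : ℝ} (hD : 0 ≤ D)
    (hle : ∫⁻ x, ‖h x - g x‖ₑ ∂μ ≤ ENNReal.ofReal D) :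
    Integrable h μ ∧ |∫ x, h x ∂μ - ∫ x, g x ∂μ| ≤ D := by
  have hsub : Integrable (fun x => h x - g x) μ :=
    ⟨hh.sub hg.1, hle.trans_lt ENNReal.ofReal_lt_top⟩
  have hint : Integrable h μ :=
    (hsub.add hg).congr (ae_of_all _ fun x => sub_add_cancel (h x) (g x))
  refine ⟨hint, ?_⟩
  rw [← integral_sub hint hg, ← norm_eq_abs, ← ENNReal.ofReal_le_ofReal_iff hD, ofReal_norm]
  exact (enorm_integral_le_lintegral_enorm _).trans hle

/-- Error of thermalizing the continuous measure. -/
theorem integrable_and_abs_thermalization_error_le {N : ℕ} {E : AffineSubspace ℝ (ZZ N)}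
    {x₀ : ZZ N} (hx₀ : x₀ ∈ E) (hdim : Module.finrank ℝ E.direction = N)
    {τ : Measure E.directionᗮ} [SFinite τ]
    (hT : MeasurePreserving
      (fun t : E.direction × E.directionᗮ => x₀ + (t.1 : ZZ N) + (t.2 : ZZ N))
      ((μH[(N : ℝ)] : Measure E.direction).prod τ) volume)
    {Φ : ZZ N → ℝ} (hΦ : Measurable Φ) {β₀ c b : ℝ} (hβ₀ : 0 < β₀) (hc : 0 < c)
    (htrans : ∀ y : ZZ N, ∀ z ∈ E, c * (‖y‖ ^ 2 + ‖z‖ ^ 2) - b ≤ β₀ * ‖y - z‖ ^ 2 + Φ y)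
    (hC1 : ∀ ξ ∈ E, ContDiff ℝ 1 (fun η : E.directionᗮ => Φ (ξ + η)))
    {C γ : ℝ} (hC : 0 < C) (hγ : 0 ≤ γ) {u : ZZ N → ℝ} (hu : ∀ ξ ∈ E, 0 ≤ u ξ)
    (hgrowth : ∀ ξ ∈ E, ∀ η : E.directionᗮ,
      ‖fderiv ℝ (fun η' : E.directionᗮ => Φ (ξ + η')) η‖ ≤ C * (1 + u ξ + ‖η‖ ^ γ))
    {ℓ : ℝ} (hℓ : 0 < ℓ) {f : ZZ N × ZZ N → ℝ} (hf1 : ∀ q, |f q| ≤ 1)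
    (hf : LipschitzWith (Real.toNNReal ℓ)⁻¹ f)
    {K : ℝ} (hK0 : 0 < K)
    (hK : ∀ β R : ℝ, 1 ≤ β → 0 ≤ R → R ^ γ * exp (-(β * R ^ 2 / 4)) ≤ K)
    (hX : ∫⁻ a : E.direction, ENNReal.ofReal (exp b * exp (-c * ‖x₀ + (a : ZZ N)‖ ^ 2) *
      (1 / ℓ + C * (1 + K) + C * u (x₀ + a))) ∂(μH[(N : ℝ)] : Measure E.direction) < ⊤)
    {β : ℝ} (hβ : 1 ≤ β) (hββ₀ : 4 * β₀ ≤ β) :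
    Integrable (fun x => (Bconst N β)⁻¹ * (f x * exp (-β * ‖x.1 - x.2‖ ^ 2)))
        ((muD N Φ).prod (muE N E)) ∧
      |∫ x, (Bconst N β)⁻¹ * (f x * exp (-β * ‖x.1 - x.2‖ ^ 2)) ∂((muD N Φ).prod (muE N E))
        - ∫ ξ in (E : Set (ZZ N)), f (ξ, ξ) * exp (-Φ ξ) ∂(μH[(N : ℝ)])| ≤
      (∫⁻ a : E.direction, ENNReal.ofReal (exp b * exp (-c * ‖x₀ + (a : ZZ N)‖ ^ 2) *
        (1 / ℓ + C * (1 + K) + C * u (x₀ + a))) ∂(μH[(N : ℝ)] : Measure E.direction)).toReal *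
          4 ^ N / √β := by
  have := isAddHaarMeasure_hausdorffMeasure_direction E hdim
  have := sFinite_muE ⟨x₀, hx₀⟩ hdim
  have hJ := measurePreserving_orthoCoord hx₀ hdim hT
  have hJm := measurable_orthoCoord E x₀
  have hgm := measurable_gapSq (E := E)
  have hβ0 : 0 < β := by linarith
  have hB := Bconst_pos (N := N) hβ0
  have hfm : Measurable f := hf.continuous.measurable
  set X : E.direction → ℝ := fun a => exp b * exp (-c * ‖x₀ + (a : ZZ N)‖ ^ 2) *
    (1 / ℓ + C * (1 + K) + C * u (x₀ + a)) with hXdef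
  let F : E.direction → ℝ := fun a => f (x₀ + a, x₀ + a) * exp (-Φ (x₀ + a))
  have hFm : Measurable F := by fun_prop
  have hF : Integrable F (μH[(N : ℝ)] : Measure E.direction) := by
    refine ⟨hFm.aestronglyMeasurable, lt_of_le_of_lt (lintegral_mono fun a => ?_)
      (lintegral_gaussian_shift_lt_top x₀ hc (exp b))⟩
    rw [← ofReal_norm, norm_mul, norm_eq_abs, norm_eq_abs, abs_exp]
    refine ENNReal.ofReal_le_ofReal ?_
    have h := exp_neg_le_of_transversal hc htrans (add_mem_of_mem_direction hx₀ a) 0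
    simp only [add_zero, norm_zero, ne_eq, OfNat.ofNat_ne_zero, not_false_eq_true, zero_pow,
      mul_zero, exp_zero, mul_one] at h
    exact (mul_le_of_le_one_left (exp_pos _).le (hf1 _)).trans h
  have htarget : ∫ ξ in (E : Set (ZZ N)), f (ξ, ξ) * exp (-Φ ξ) ∂(μH[(N : ℝ)]) =
      ∫ t : (E.direction × E.directionᗮ) × E.direction,
        (Bconst N β)⁻¹ * (F t.1.1 * exp (-β * gapSq t))
          ∂(((μH[(N : ℝ)] : Measure E.direction).prod τ).prod μH[(N : ℝ)]) := by
    rw [integral_const_mul, integral_mul_exp_gapSq hT hβ0 hFm hF]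
    change ∫ ξ, f (ξ, ξ) * exp (-Φ ξ) ∂(muE N E) = _
    rw [muE_eq_map E hx₀, (measurableEmbedding_add_direction E x₀).integral_map]
    field_simp
    rfl
  rw [htarget, integral_muD_prod_muE hΦ hJ (by fun_prop),
    integrable_muD_prod_muE_iff hΦ hJ (by fun_prop)]
  refine integrable_and_abs_integral_sub_le
    ((integrable_mul_exp_gapSq hT hβ0 hFm hF).const_mul _) (by fun_prop) (by positivity) ?_
  have hbound := lintegral_le_mul_Bconst hT (s := 1 / 4 * β) (by positivity)
    (fun t => ‖exp (-Φ (orthoCoord E x₀ t).1) * ((Bconst N β)⁻¹ * (f (orthoCoord E x₀ t) *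
        exp (-β * ‖(orthoCoord E x₀ t).1 - (orthoCoord E x₀ t).2‖ ^ 2)))
        - (Bconst N β)⁻¹ * (F t.1.1 * exp (-β * gapSq t))‖ₑ) (by fun_prop)
    (fun a => ENNReal.ofReal ((Bconst N β)⁻¹ * (1 / √β)) * ENNReal.ofReal (X a)) fun t => by
      have hX0 : 0 ≤ X t.1.1 := by
        have := hu _ (add_mem_of_mem_direction hx₀ t.1.1)
        positivity
      have hgap0 : 0 ≤ gapSq t := by unfold gapSq; positivity
      have hR : √(gapSq t) ^ 2 = gapSq t := sq_sqrt hgap0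
      have hpt := abs_thermalization_integrand_le hβ₀ hc htrans hC hγ
        (hu _ (add_mem_of_mem_direction hx₀ t.1.1)) (z := x₀ + (t.2 : ZZ N))
        (add_mem_of_mem_direction hx₀ t.1.1) (hC1 _ (add_mem_of_mem_direction hx₀ t.1.1))
        (hgrowth _ (add_mem_of_mem_direction hx₀ t.1.1)) hℓ hf1 hf hK hβ hββ₀ t.1.2
        (sqrt_nonneg (gapSq t))
        (le_sqrt_of_sq_le (le_add_of_nonneg_right (sq_nonneg _)))
        (le_sqrt_of_sq_le (by
          rw [add_sub_add_left_eq_sub, norm_sub_rev]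
          exact le_add_of_nonneg_left (sq_nonneg _)))
      rw [hR] at hpt
      rw [norm_sq_orthoCoord_sub, ← ENNReal.ofReal_mul (by positivity),
        ← ENNReal.ofReal_mul (by positivity), ← ofReal_norm, norm_eq_abs]
      refine ENNReal.ofReal_le_ofReal ?_
      have hfactor : exp (-Φ (orthoCoord E x₀ t).1) * ((Bconst N β)⁻¹ * (f (orthoCoord E x₀ t) *
          exp (-β * gapSq t))) - (Bconst N β)⁻¹ * (F t.1.1 * exp (-β * gapSq t)) =
          (Bconst N β)⁻¹ * ((f (orthoCoord E x₀ t) * exp (-Φ (orthoCoord E x₀ t).1) - F t.1.1) *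
            exp (-β * gapSq t)) := by ring
      rw [hfactor, abs_mul, abs_mul, abs_exp, abs_of_pos (inv_pos.2 hB)]
      calc _ ≤ (Bconst N β)⁻¹ * (1 / √β * X t.1.1 * exp (-(β / 4) * gapSq t)) :=
            mul_le_mul_of_nonneg_left hpt (inv_pos.2 hB).le
        _ = _ := by
          rw [show -(β / 4) = -(1 / 4 * β) by ring]
          ring
  refine hbound.trans (le_of_eq ?_)
  rw [lintegral_const_mul' _ _ ENNReal.ofReal_ne_top, ← ENNReal.ofReal_toReal hX.ne,
    ← ENNReal.ofReal_mul (by positivity), ← ENNReal.ofReal_mul (by positivity),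
    Bconst_mul_left (by norm_num) hβ0, ENNReal.toReal_ofReal ENNReal.toReal_nonneg]
  congr 1
  field_simp

/-- Error of replacing the continuous material measure by its discretization. -/
theorem abs_discretization_error_le {N : ℕ} {E : AffineSubspace ℝ (ZZ N)}
    {x₀ : ZZ N} (hx₀ : x₀ ∈ E) (hdim : Module.finrank ℝ E.direction = N)
    {τ : Measure E.directionᗮ} [SFinite τ]
    (hT : MeasurePreserving
      (fun t : E.direction × E.directionᗮ => x₀ + (t.1 : ZZ N) + (t.2 : ZZ N))
      ((μH[(N : ℝ)] : Measure E.direction).prod τ) volume)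
    {Φ : ZZ N → ℝ} (hΦ : Measurable Φ) {β₀ c b : ℝ} (hβ₀ : 0 < β₀) (hc : 0 < c)
    (htrans : ∀ y : ZZ N, ∀ z ∈ E, c * (‖y‖ ^ 2 + ‖z‖ ^ 2) - b ≤ β₀ * ‖y - z‖ ^ 2 + Φ y)
    {ι : Type*} [Countable ι] {A : ι → Set (ZZ N)} {p : ι → ZZ N}
    (hAmeas : ∀ i, MeasurableSet (A i)) (hdisj : Pairwise fun i j => Disjoint (A i) (A j))
    (hcover : (⋃ i, A i) = Set.univ) (hfin : ∀ i, (muD N Φ) (A i) < ⊤)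
    {ℓ β ε Cb cstar : ℝ} (hℓ : 0 < ℓ) (hβ : 1 ≤ β) (hββ₀ : 8 * β₀ * cstar ^ 2 ≤ β)
    (hε : 0 < ε) (hβε : β * ε ^ 2 ≤ Cb) (hcstar : 1 ≤ cstar)
    (hmom : ∀ i, ∫⁻ y in A i, ENNReal.ofReal (‖y - p i‖ ^ 2) ∂(muD N Φ)
      ≤ ENNReal.ofReal (ε ^ 2) * (muD N Φ) (A i))
    (hcell : ∀ i, ∀ z ∈ E, ∀ y ∈ A i,
      ‖p i - z‖ ^ 2 ≤ cstar ^ 2 * (ε ^ 2 + ‖y - z‖ ^ 2))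
    {f : ZZ N × ZZ N → ℝ} (hf1 : ∀ x, |f x| ≤ 1) (hf : LipschitzWith (Real.toNNReal ℓ)⁻¹ f)
    (hint : Integrable (fun x => (Bconst N β)⁻¹ * (f x * exp (-β * ‖x.1 - x.2‖ ^ 2)))
        ((muD N Φ).prod (muE N E))) :
    |∫ q, f q ∂(therm ((Measure.sum fun i => (muD N Φ) (A i) • Measure.dirac (p i)).prod
          (muE N E)) β)
        - ∫ x, (Bconst N β)⁻¹ * (f x * exp (-β * ‖x.1 - x.2‖ ^ 2))
          ∂((muD N Φ).prod (muE N E))| ≤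
      (1 / ℓ + 2 * exp (Cb / 2)) * (2 * exp Cb) *
        ((∫⁻ a : E.direction, ENNReal.ofReal (exp b * exp (-c * ‖x₀ + (a : ZZ N)‖ ^ 2))
          ∂(μH[(N : ℝ)] : Measure E.direction)).toReal * (8 * cstar ^ 2) ^ N) * √β * ε := by
  have := isAddHaarMeasure_hausdorffMeasure_direction E hdim
  have := sFinite_muE ⟨x₀, hx₀⟩ hdim
  have := sFinite_muD Φ
  have hβ0 : 0 < β := by linarith
  have hc0 : 0 < cstar := by linarith
  have hB := Bconst_pos (N := N) hβ0
  have hfm : Measurable f := hf.continuous.measurable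
  obtain ⟨q, hqm, hq, hmap⟩ :=
    exists_measurable_sum_dirac_eq_map (muD N Φ) (p := p) hAmeas hdisj hcover
  rw [hmap, integral_therm_map_prod hqm hβ0 hfm]
  refine (integrable_and_abs_integral_sub_le hint (by fun_prop) (by positivity) ?_).2
  have hmass := lintegral_gaussian_muD_prod_muE_le hx₀ hdim hT hΦ hβ₀ hc htrans
    (s := 1 / (4 * cstar ^ 2) * β) (by
      rw [div_mul_eq_mul_div, le_div_iff₀ (by positivity)]
      linarith)
  have hxhat := lintegral_gaussian_shift_lt_top x₀
    (lam := (μH[(N : ℝ)] : Measure E.direction)) hc (exp b)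
  calc ∫⁻ x, ‖(Bconst N β)⁻¹ * (f (q x.1, x.2) * exp (-β * ‖q x.1 - x.2‖ ^ 2))
        - (Bconst N β)⁻¹ * (f x * exp (-β * ‖x.1 - x.2‖ ^ 2))‖ₑ ∂((muD N Φ).prod (muE N E))
      = ENNReal.ofReal (Bconst N β)⁻¹ * ∫⁻ x, ‖f (q x.1, x.2) * exp (-β * ‖q x.1 - x.2‖ ^ 2)
        - f x * exp (-β * ‖x.1 - x.2‖ ^ 2)‖ₑ ∂((muD N Φ).prod (muE N E)) := by
        rw [← lintegral_const_mul' _ _ ENNReal.ofReal_ne_top]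
        refine lintegral_congr fun x => ?_
        rw [← mul_sub, enorm_mul, enorm_of_nonneg (inv_pos.2 hB).le]
    _ ≤ ENNReal.ofReal (Bconst N β)⁻¹ *
          (ENNReal.ofReal ((1 / ℓ + 2 * exp (Cb / 2)) * √β * (2 * ε * exp Cb)) * _) := by
        gcongr
        exact (lintegral_discretization_le hAmeas hdisj hcover hfin hℓ hβ hε hβε hcstar hmom
          hcell hqm hq hf1 hf).trans (mul_le_mul_right hmass _)
    _ = _ := by
        rw [← ENNReal.ofReal_toReal hxhat.ne, ← ENNReal.ofReal_mul (by positivity),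
          ← ENNReal.ofReal_mul (by positivity), ← ENNReal.ofReal_mul (by positivity),
          ← mul_assoc, ← mul_assoc (1 / 2 : ℝ), Bconst_mul_left (by positivity) hβ0,
          ENNReal.toReal_ofReal ENNReal.toReal_nonneg]
        congr 1
        rw [show (1 / 2 * (1 / (4 * cstar ^ 2)))⁻¹ = 8 * cstar ^ 2 by field_simp; norm_num]
        field_simp

theorem lintegral_growth_lt_top {N : ℕ} {E : AffineSubspace ℝ (ZZ N)}
    {x₀ : ZZ N} (hx₀ : x₀ ∈ E) (hdim : Module.finrank ℝ E.direction = N)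
    {c C : ℝ} (b : ℝ) (hc : 0 < c) (hC : 0 < C) {u : ZZ N → ℝ} (hu : ∀ ξ ∈ E, 0 ≤ u ξ)
    (huint : ∫⁻ ξ in (E : Set (ZZ N)),
        ENNReal.ofReal (u ξ * exp (-c * ‖ξ‖ ^ 2 / 4)) ∂(μH[(N : ℝ)]) < ⊤)
    {D : ℝ} (hD : 0 ≤ D) :
    ∫⁻ a : E.direction, ENNReal.ofReal (exp b * exp (-c * ‖x₀ + (a : ZZ N)‖ ^ 2) *
      (D + C * u (x₀ + a))) ∂(μH[(N : ℝ)] : Measure E.direction) < ⊤ := by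
  have := isAddHaarMeasure_hausdorffMeasure_direction E hdim
  change ∫⁻ ξ, ENNReal.ofReal (u ξ * exp (-c * ‖ξ‖ ^ 2 / 4)) ∂(muE N E) < ⊤ at huint
  rw [muE_eq_map E hx₀, (measurableEmbedding_add_direction E x₀).lintegral_map] at huint
  calc _ ≤ ∫⁻ a : E.direction,
        (ENNReal.ofReal (exp b * D * exp (-c * ‖x₀ + (a : ZZ N)‖ ^ 2)) +
          ENNReal.ofReal (exp b * C) * ENNReal.ofReal (u (x₀ + a) *
            exp (-c * ‖x₀ + (a : ZZ N)‖ ^ 2 / 4))) ∂(μH[(N : ℝ)] : Measure E.direction) := by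
        refine lintegral_mono fun a => ?_
        have hu0 := hu _ (add_mem_of_mem_direction hx₀ a)
        rw [← ENNReal.ofReal_mul (by positivity),
          ← ENNReal.ofReal_add (by positivity) (by positivity)]
        refine ENNReal.ofReal_le_ofReal ?_
        have he : exp (-c * ‖x₀ + (a : ZZ N)‖ ^ 2) ≤ exp (-c * ‖x₀ + (a : ZZ N)‖ ^ 2 / 4) :=
          exp_le_exp.2 (by nlinarith [mul_nonneg hc.le (sq_nonneg ‖x₀ + (a : ZZ N)‖)])
        calc _ = exp b * D * exp (-c * ‖x₀ + (a : ZZ N)‖ ^ 2) +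
              exp b * C * (u (x₀ + a) * exp (-c * ‖x₀ + (a : ZZ N)‖ ^ 2)) := by ring
          _ ≤ _ := by gcongr
    _ < ⊤ := by
        rw [lintegral_add_left (by fun_prop), lintegral_const_mul' _ _ ENNReal.ofReal_ne_top]
        exact ENNReal.add_lt_top.2 ⟨lintegral_gaussian_shift_lt_top x₀ hc _,
          ENNReal.mul_lt_top ENNReal.ofReal_lt_top huint⟩

theorem discrete_subGaussian_total_error
    (N : ℕ) (E : AffineSubspace ℝ (ZZ N)) (hE : (E : Set (ZZ N)).Nonempty)
    (hdim : Module.finrank ℝ E.direction = N)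
    (ℓ : ℝ) (hℓ : 0 < ℓ)
    (Φ : ZZ N → ℝ) (hΦ : Measurable Φ)
    -- sub-Gaussian transversality condition
    (β₀ c b : ℝ) (hβ₀ : 0 < β₀) (hc : 0 < c) (hb : 0 < b)
    (htrans : ∀ y : ZZ N, ∀ z ∈ E, c * (‖y‖ ^ 2 + ‖z‖ ^ 2) - b ≤ β₀ * ‖y - z‖ ^ 2 + Φ y)
    -- regularity and growth of Ψ(ξ,η) = Φ(ξ+η)
    (hC1 : ∀ ξ ∈ E, ContDiff ℝ 1 (fun η : E.directionᗮ => Φ (ξ + η)))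
    (C : ℝ) (hC : 0 < C) (γ : ℝ) (hγ : 0 ≤ γ)
    (u : ZZ N → ℝ) (hu : ∀ ξ ∈ E, 0 ≤ u ξ)
    (huint : ∫⁻ ξ in (E : Set (ZZ N)),
        ENNReal.ofReal (u ξ * Real.exp (-c * ‖ξ‖ ^ 2 / 4)) ∂(μH[(N : ℝ)]) < ⊤)
    (hgrowth : ∀ ξ ∈ E, ∀ η : E.directionᗮ,
        ‖fderiv ℝ (fun η' : E.directionᗮ => Φ (ξ + η')) η‖ ≤ C * (1 + u ξ + ‖η‖ ^ γ))
    -- annealing and resolution sequences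
    (β : ℕ → ℝ) (hβ : Tendsto β atTop atTop)
    (ε : ℕ → ℝ) (hεpos : ∀ h, 0 < ε h) (hε : Tendsto ε atTop (𝓝 0))
    (hβε : ∃ Cb : ℝ, ∀ h, |β h * (ε h) ^ 2| ≤ Cb)
    -- for every h, a countable Borel partition {A_p : p ∈ P_h} of Z with p ∈ A_p
    (ι : ℕ → Type) [∀ h, Countable (ι h)]
    (p : ∀ h, ι h → ZZ N) (A : ∀ h, ι h → Set (ZZ N))
    (hAmeas : ∀ h i, MeasurableSet (A h i))
    (hdisj : ∀ h, Pairwise fun i j => Disjoint (A h i) (A h j))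
    (hcover : ∀ h, (⋃ i, A h i) = Set.univ)
    (hpA : ∀ h i, p h i ∈ A h i)
    (hAfin : ∀ h i, (muD N Φ) (A h i) < ⊤)
    (cstar : ℝ) (hcstar : 1 ≤ cstar)
    (hcell : ∀ h, ∀ i, ∀ z ∈ E, ∀ y ∈ A h i,
      ‖p h i - z‖ ^ 2 ≤ cstar ^ 2 * ((ε h) ^ 2 + ‖y - z‖ ^ 2))
    (hmom : ∀ h i, ∫⁻ y in A h i, ENNReal.ofReal (‖y - p h i‖ ^ 2) ∂(muD N Φ)
      ≤ ENNReal.ofReal ((ε h) ^ 2) * (muD N Φ) (A h i)) :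
    ∃ C₁ : ℝ, 0 < C₁ ∧ ∃ C₂ : ℝ, 0 < C₂ ∧ ∃ h₀ : ℕ, ∀ h, h₀ ≤ h →
      ∀ f : ZZ N × ZZ N → ℝ, (∀ q, |f q| ≤ 1) →
        LipschitzWith (Real.toNNReal ℓ)⁻¹ f →
        (∫ q, f q ∂(therm
            ((Measure.sum fun i => (muD N Φ) (A h i) • Measure.dirac (p h i)).prod
              (muE N E)) (β h))) -
          (∫ ξ in (E : Set (ZZ N)), f (ξ, ξ) * Real.exp (-Φ ξ) ∂(μH[(N : ℝ)]))
          ≤ C₁ / Real.sqrt (β h) + C₂ * Real.sqrt (β h) * ε h := by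
  obtain ⟨x₀, hx₀⟩ := hE
  have hx₀ : x₀ ∈ E := hx₀
  have := isAddHaarMeasure_hausdorffMeasure_direction E hdim
  obtain ⟨τ, _, hT⟩ := exists_measurePreserving_add_orthogonal E.direction
    (μH[(N : ℝ)] : Measure E.direction) x₀
  obtain ⟨Cb, hCb⟩ := hβε
  obtain ⟨K, hK0, hK⟩ := exists_rpow_mul_exp_neg_sq_le γ hγ
  have hX := lintegral_growth_lt_top hx₀ hdim b hc hC hu huint
    (D := 1 / ℓ + C * (1 + K)) (by positivity)
  set X := ∫⁻ a : E.direction, ENNReal.ofReal (exp b * exp (-c * ‖x₀ + (a : ZZ N)‖ ^ 2) *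
    (1 / ℓ + C * (1 + K) + C * u (x₀ + a))) ∂(μH[(N : ℝ)] : Measure E.direction) with hXdef
  set C₂ := (1 / ℓ + 2 * exp (Cb / 2)) * (2 * exp Cb) *
    ((∫⁻ a : E.direction, ENNReal.ofReal (exp b * exp (-c * ‖x₀ + (a : ZZ N)‖ ^ 2))
      ∂(μH[(N : ℝ)] : Measure E.direction)).toReal * (8 * cstar ^ 2) ^ N) with hC₂
  obtain ⟨h₀, hh₀⟩ := eventually_atTop.1 (hβ.eventually_ge_atTop
    (max 1 (max (4 * β₀) (8 * β₀ * cstar ^ 2))))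
  have hC₂0 : 0 ≤ C₂ := by positivity
  refine ⟨X.toReal * 4 ^ N + 1, by positivity, C₂ + 1, by positivity, h₀,
    fun h hh f hf1 hf => ?_⟩
  have hβh := hh₀ h hh
  simp only [max_le_iff] at hβh
  obtain ⟨hβ1, hβ2, hβ3⟩ := hβh
  obtain ⟨hint, herr⟩ := integrable_and_abs_thermalization_error_le hx₀ hdim hT hΦ hβ₀ hc htrans
    hC1 hC hγ hu hgrowth hℓ hf1 hf hK0 hK hX hβ1 hβ2
  have hdisc := abs_discretization_error_le hx₀ hdim hT hΦ hβ₀ hc htrans (hAmeas h) (hdisj h)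
    (hcover h) (hAfin h) hℓ hβ1 hβ3 (hεpos h) ((le_abs_self _).trans (hCb h)) hcstar (hmom h)
    (hcell h) hf1 hf hint
  rw [← hC₂] at hdisc
  rw [← hXdef] at herr
  have h1 : X.toReal * 4 ^ N / √(β h) ≤ (X.toReal * 4 ^ N + 1) / √(β h) := by
    gcongr
    linarith
  have h2 : C₂ * √(β h) * ε h ≤ (C₂ + 1) * √(β h) * ε h := by
    have := (hεpos h).le
    gcongr
    linarith
  linarith [le_abs_self (α := ℝ) _ |>.trans hdisc, le_abs_self (α := ℝ) _ |>.trans herr]
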